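/- arXiv:0807.3869 — 2 statements merged into one kernel-verified Lean document; each statement's English description precedes it below -/
import Mathlib

section
/- Let k be a field and A a differential graded k-algebra such that H_*(A) is a free k-module. Then there exists an A_∞-algebra structure {m_n} on H_*(A) and an A_∞-algebra quasi-isomorphism f = {f_n} : H_*(A) → A such that m_1 = 0, m_2 is the multiplication induced on homology classes by the product of A, and f_1 is a cycle-choosing quasi-isomorphism of dg-vector spaces (i.e. f_1 sends each homology class to a cycle representing it). Moreover, if A has a unit 1, the structure and the quasi-isomorphism can be chosen strictly unital, i.e. for all k ≥ 2, all scalars λ ∈ k and all arguments, f_k(a_1,…,a_{i-1}, λ·1, a_{i+1},…,a_k) = 0, and for all k ≥ 3, m_k(a_1,…,a_{i-1}, λ·1, a_{i+1},…,a_k) = 0. -/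
/-!
Cycle-level encoding of `A_∞`-structures on the homology of a differential graded
algebra, following Kadeishvili.

A dg-algebra is presented as a `k`-algebra `A` with a grading `𝒜 : ℤ → Submodule k A`
(a graded monoid giving a direct sum decomposition) and a degree `+1` square-zero
differential `d` satisfying the graded Leibniz rule.

Elements of the homology `H = ker d / im d` are encoded by representing cycles.
A family of multilinear maps `(g_n : H^{⊗n} → A)_n` (resp. with values in `H`) is
encoded by a single function `F : List A → A` (the arity being the list length),
evaluated on lists of representing cycles; that `F` genuinely comes from a family
of multilinear maps on homology is expressed by the predicates below.
-/

open LinearMap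

/-- The integer sign `(-1) ^ e` associated to an integer exponent `e`. -/
def gsign (e : ℤ) : ℤ := if Even e then 1 else -1

variable {k A : Type*} [Field k] [Ring A] [Algebra k A]

/-- `(𝒜, d)` make the `k`-algebra `A` into a differential graded algebra. -/
structure IsDGAlgebra (𝒜 : ℤ → Submodule k A) (d : A →ₗ[k] A) : Prop where
  d_sq : ∀ x : A, d (d x) = 0
  d_deg : ∀ (i : ℤ), ∀ x ∈ 𝒜 i, d x ∈ 𝒜 (i + 1)
  leibniz : ∀ (i : ℤ), ∀ x ∈ 𝒜 i, ∀ y : A, d (x * y) = d x * y + gsign i • (x * d y)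

/-- Every member of `a` is a cycle. -/
def IsCycleList (d : A →ₗ[k] A) (a : List A) : Prop :=
  ∀ x ∈ a, x ∈ LinearMap.ker d

/-- `a` and `b` are entrywise homologous lists of cycles. -/
def HomologyEquiv (d : A →ₗ[k] A) (a b : List A) : Prop :=
  List.Forall₂
    (fun x y => x ∈ LinearMap.ker d ∧ y ∈ LinearMap.ker d ∧ x - y ∈ LinearMap.range d) a b

/-- `a` is a list of homogeneous elements whose degrees are listed in `ds`. -/
def IsHomogeneousList (𝒜 : ℤ → Submodule k A) (ds : List ℤ) (a : List A) : Prop :=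
  List.Forall₂ (fun x i => x ∈ 𝒜 i) a ds

/-- `F : List A → A` encodes, at every arity `≤ N`, a `k`-multilinear map on homology
classes (evaluated on lists of representing cycles) with values in `A`. -/
structure EncodesFamily (d : A →ₗ[k] A) (F : List A → A) (N : ℕ) : Prop where
  congr : ∀ a b : List A, a.length ≤ N → HomologyEquiv d a b → F a = F b
  map_add : ∀ (pre : List A) (u v : A) (post : List A),
    pre.length + post.length + 1 ≤ N → IsCycleList d pre →
    u ∈ LinearMap.ker d → v ∈ LinearMap.ker d → IsCycleList d post →
    F (pre ++ (u + v) :: post) = F (pre ++ u :: post) + F (pre ++ v :: post)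
  map_smul : ∀ (pre : List A) (c : k) (u : A) (post : List A),
    pre.length + post.length + 1 ≤ N → IsCycleList d pre →
    u ∈ LinearMap.ker d → IsCycleList d post →
    F (pre ++ (c • u) :: post) = c • F (pre ++ u :: post)

/-- `M : List A → A` encodes, at every arity `≤ N`, a `k`-multilinear operation on
homology with values in homology: the value on representing cycles is a (canonically
chosen) representing cycle of the resulting class. -/
structure EncodesOps (d : A →ₗ[k] A) (M : List A → A) (N : ℕ)
    extends EncodesFamily d M N : Prop where
  mem_ker : ∀ a : List A, a.length ≤ N → IsCycleList d a → M a ∈ LinearMap.ker d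

/-- At arity one, `F` encodes a cycle-choosing map `f₁ : H → A`: it sends (the class
of) a cycle `u` to a cycle homologous to `u`. -/
structure IsCycleChoosing (d : A →ₗ[k] A) (F : List A → A) : Prop where
  mem_ker : ∀ u ∈ LinearMap.ker d, F [u] ∈ LinearMap.ker d
  sub_mem : ∀ u ∈ LinearMap.ker d, F [u] - u ∈ LinearMap.range d

/-- The operations `mₙ` encoded by `M` have degree `2 - n`, for `n ≤ N`. -/
def OpsHaveDegree (𝒜 : ℤ → Submodule k A) (M : List A → A) (N : ℕ) : Prop :=
  ∀ (ds : List ℤ) (a : List A), a.length ≤ N → IsHomogeneousList 𝒜 ds a →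
    M a ∈ 𝒜 (ds.sum + 2 - a.length)

/-- The maps `fₙ` encoded by `F` have degree `1 - n`, for `n ≤ N`. -/
def MapsHaveDegree (𝒜 : ℤ → Submodule k A) (F : List A → A) (N : ℕ) : Prop :=
  ∀ (ds : List ℤ) (a : List A), a.length ≤ N → IsHomogeneousList 𝒜 ds a →
    F a ∈ 𝒜 (ds.sum + 1 - a.length)

/-- `m₁ = 0` on homology: the value of `M` at arity one represents the zero class. -/
def MOneZero (d : A →ₗ[k] A) (M : List A → A) : Prop :=
  ∀ u ∈ LinearMap.ker d, M [u] ∈ LinearMap.range d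

/-- `m₂` is the multiplication induced on homology by the product of `A`. -/
def MTwoInduced (d : A →ₗ[k] A) (M : List A → A) : Prop :=
  ∀ u ∈ LinearMap.ker d, ∀ v ∈ LinearMap.ker d, M [u, v] - u * v ∈ LinearMap.range d

/-- Kadeishvili's obstruction
`Ψₙ(a₁,…,aₙ) = ∑_{s=1}^{n-1} (-1)^{ε₁(s)} f_s(a₁,…,a_s)·f_{n-s}(a_{s+1},…,aₙ)
  + ∑_{j=2}^{n-1} ∑_{t=0}^{n-j} (-1)^{ε₂(t,j)} f_{n-j+1}(a₁,…,a_t, m_j(a_{t+1},…,a_{t+j}),…,aₙ)`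
with `ε₁(s) = s + (n-s+1)(|a₁|+⋯+|a_s|)` and `ε₂(t,j) = t + j(n-t-j+|a₁|+⋯+|a_t|)`,
evaluated on a list `a` of representing cycles with degree list `ds`; `n = a.length`. -/
def Psi (F M : List A → A) (ds : List ℤ) (a : List A) : A :=
  (∑ s ∈ Finset.Ioo 0 a.length,
      gsign ((s : ℤ) + ((a.length : ℤ) - (s : ℤ) + 1) * (ds.take s).sum) •
        (F (a.take s) * F (a.drop s))) +
  ∑ j ∈ Finset.Icc 2 (a.length - 1), ∑ t ∈ Finset.Icc 0 (a.length - j),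
      gsign ((t : ℤ) + (j : ℤ) * ((a.length : ℤ) - (t : ℤ) - (j : ℤ) + (ds.take t).sum)) •
        F (a.take t ++ M ((a.drop t).take j) :: a.drop (t + j))

/-- The Stasheff sum `∑_{r+s+t=n} (-1)^{r+st} m_{r+1+t}(1^{⊗r} ⊗ m_s ⊗ 1^{⊗t})`,
evaluated (with the Koszul sign `(-1)^{s(|a₁|+⋯+|a_r|)}`) on a list `a` of
representing cycles with degree list `ds`. -/
def StasheffSum (M : List A → A) (ds : List ℤ) (a : List A) : A :=
  ∑ r ∈ Finset.range a.length, ∑ s ∈ Finset.Icc 1 (a.length - r),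
    gsign ((r : ℤ) + (s : ℤ) * ((a.length : ℤ) - (r : ℤ) - (s : ℤ)) +
        (s : ℤ) * (ds.take r).sum) •
      M (a.take r ++ M ((a.drop r).take s) :: a.drop (r + s))

/-- The Stasheff identity `Stₙ` holds on homology at every arity `n ≤ N`. -/
def SatisfiesStasheff (d : A →ₗ[k] A) (𝒜 : ℤ → Submodule k A) (M : List A → A)
    (N : ℕ) : Prop :=
  ∀ (ds : List ℤ) (a : List A), a.length ≤ N → IsCycleList d a →
    IsHomogeneousList 𝒜 ds a → StasheffSum M ds a ∈ LinearMap.range d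

/-- The `A_∞`-operations of the dg-algebra `A` itself: `m₁ = d`, `m₂` the product,
and `mₙ = 0` for `n ≥ 3`. -/
def dgOps (d : A →ₗ[k] A) : List A → A
  | [x] => d x
  | [x, y] => x * y
  | _ => 0

/-- The exponent `w = (q-1)(i₁-1) + (q-2)(i₂-1) + ⋯ + (i_{q-1}-1)` attached to a
composition with blocks `bs = [i₁, …, i_q]`. -/
def wExp (bs : List ℕ) : ℤ :=
  ∑ p ∈ Finset.range bs.length,
    ((bs.length : ℤ) - 1 - (p : ℤ)) * ((bs.getD p 0 : ℤ) - 1)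

/-- The Koszul sign exponent arising when evaluating `f_{i₁} ⊗ ⋯ ⊗ f_{i_q}` on
homogeneous elements whose degrees are grouped into blocks `dbs`:
`∑_p (1 - i_p)·(sum of the degrees in the blocks before block p)`. -/
def koszulExp (dbs : List (List ℤ)) : ℤ :=
  ∑ p ∈ Finset.range dbs.length,
    (1 - ((dbs.getD p []).length : ℤ)) * ((dbs.take p).map List.sum).sum

/-- Left-hand side `∑_{r+s+t=n} (-1)^{r+st} f_{r+1+t}(1^{⊗r} ⊗ m_s ⊗ 1^{⊗t})` of the
Stasheff morphism identity `Stᵐₙ`, with Koszul signs, on representing cycles. -/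
def MorphismLHS (F M : List A → A) (ds : List ℤ) (a : List A) : A :=
  ∑ r ∈ Finset.range a.length, ∑ s ∈ Finset.Icc 1 (a.length - r),
    gsign ((r : ℤ) + (s : ℤ) * ((a.length : ℤ) - (r : ℤ) - (s : ℤ)) +
        (s : ℤ) * (ds.take r).sum) •
      F (a.take r ++ M ((a.drop r).take s) :: a.drop (r + s))

/-- Right-hand side `∑_{i₁+⋯+i_q=n} (-1)^w m_q(f_{i₁} ⊗ ⋯ ⊗ f_{i_q})` of the Stasheff
morphism identity `Stᵐₙ`, with Koszul signs; here the `m_q` are the dg-operations of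
the target `A` (`m₁ = d`, `m₂` the product, `mₙ = 0` otherwise). -/
def MorphismRHS (d : A →ₗ[k] A) (F : List A → A) (ds : List ℤ) (a : List A) : A :=
  ∑ c : Composition a.length,
    gsign (wExp c.blocks + koszulExp (ds.splitWrtComposition c)) •
      dgOps d ((a.splitWrtComposition c).map F)

/-- The Stasheff morphism identity `Stᵐₙ` holds at every arity `n ≤ N`. -/
def SatisfiesStasheffMorph (d : A →ₗ[k] A) (𝒜 : ℤ → Submodule k A)
    (F M : List A → A) (N : ℕ) : Prop :=
  ∀ (ds : List ℤ) (a : List A), a.length ≤ N → IsCycleList d a →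
    IsHomogeneousList 𝒜 ds a → MorphismLHS F M ds a = MorphismRHS d F ds a

/-- The arity-`n` data was chosen according to the Kadeishvili algorithm (`n ≥ 3`):
`mₙ(a)` is the homology class of the cycle `Ψₙ(a)`, and `d fₙ(a) = Ψₙ(a) - f₁(mₙ(a))`. -/
def KadeishviliAt (d : A →ₗ[k] A) (𝒜 : ℤ → Submodule k A) (F M : List A → A)
    (n : ℕ) : Prop :=
  ∀ (ds : List ℤ) (a : List A), a.length = n → IsCycleList d a →
    IsHomogeneousList 𝒜 ds a →
      M a - Psi F M ds a ∈ LinearMap.range d ∧ d (F a) = Psi F M ds a - F [M a]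

/-- The arity-two map `f₂` was chosen according to the Kadeishvili algorithm:
`d f₂(a₁,a₂) = f₁(a₁)f₁(a₂) - f₁(a₁a₂)`. -/
def KadeishviliTwo (d : A →ₗ[k] A) (F : List A → A) : Prop :=
  ∀ u ∈ LinearMap.ker d, ∀ v ∈ LinearMap.ker d,
    d (F [u, v]) = F [u] * F [v] - F [u * v]

/-- `M` encodes `k[z]`-multilinear operations (up to arity `N`):
`mₙ(a₁,…,z·aᵢ,…,aₙ) = z·mₙ(a₁,…,aₙ)` on homology. -/
def OpsZLinear (d : A →ₗ[k] A) (z₀ : A) (M : List A → A) (N : ℕ) : Prop :=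
  ∀ (pre : List A) (u : A) (post : List A), pre.length + post.length + 1 ≤ N →
    IsCycleList d pre → u ∈ LinearMap.ker d → IsCycleList d post →
    M (pre ++ (z₀ * u) :: post) - z₀ * M (pre ++ u :: post) ∈ LinearMap.range d

/-- `F` encodes `k[z]`-multilinear maps (up to arity `N`):
`fₙ(a₁,…,z·aᵢ,…,aₙ) = f₁(z)·fₙ(a₁,…,aₙ)` in `A`. -/
def MapsZLinear (d : A →ₗ[k] A) (z₀ : A) (F : List A → A) (N : ℕ) : Prop :=
  ∀ (pre : List A) (u : A) (post : List A), pre.length + post.length + 1 ≤ N →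
    IsCycleList d pre → u ∈ LinearMap.ker d → IsCycleList d post →
    F (pre ++ (z₀ * u) :: post) = F [z₀] * F (pre ++ u :: post)

/-- `ζ = f₁(z)` commutes with all the values of `F` (up to arity `N`). -/
def ZetaCommutes (d : A →ₗ[k] A) (z₀ : A) (F : List A → A) (N : ℕ) : Prop :=
  ∀ a : List A, a.length ≤ N → IsCycleList d a → F [z₀] * F a = F a * F [z₀]

/-! ### Sums over the ways of cutting a list in two -/

section SplitSum

variable {α β γ : Type*} [AddCommMonoid β] [AddCommMonoid γ]

/-- The sum of `φ x y` over all the ways of writing the list as `x ++ y`. -/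
def splitSum (φ : List α → List α → β) (a : List α) : β :=
  ∑ s ∈ Finset.range (a.length + 1), φ (a.take s) (a.drop s)

@[simp]
lemma splitSum_nil (φ : List α → List α → β) : splitSum φ [] = φ [] [] := by
  simp [splitSum]

lemma splitSum_cons (φ : List α → List α → β) (x : α) (l : List α) :
    splitSum φ (x :: l) = φ [] (x :: l) + splitSum (fun u v => φ (x :: u) v) l := by
  simp only [splitSum, List.length_cons]
  rw [Finset.sum_range_succ', add_comm]
  simp

lemma splitSum_congr {φ ψ : List α → List α → β} {a : List α}
    (h : ∀ x y, x ++ y = a → φ x y = ψ x y) : splitSum φ a = splitSum ψ a :=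
  Finset.sum_congr rfl fun _ _ => h _ _ (List.take_append_drop _ _)

lemma splitSum_eq_zero {φ : List α → List α → β} {a : List α}
    (h : ∀ x y, x ++ y = a → φ x y = 0) : splitSum φ a = 0 :=
  Finset.sum_eq_zero fun _ _ => h _ _ (List.take_append_drop _ _)

lemma splitSum_eq_left {φ : List α → List α → β} {a : List α}
    (h : ∀ x y, x ++ y = a → x ≠ [] → φ x y = 0) : splitSum φ a = φ [] a := by
  cases a with
  | nil => simp
  | cons c l =>
    rw [splitSum_cons, splitSum_eq_zero, add_zero]
    intro x y hxy
    exact h _ _ (by simp [hxy]) (by simp)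

lemma splitSum_eq_right {φ : List α → List α → β} {a : List α}
    (h : ∀ x y, x ++ y = a → y ≠ [] → φ x y = 0) : splitSum φ a = φ a [] := by
  induction a generalizing φ with
  | nil => simp
  | cons c l ih =>
    rw [splitSum_cons, h [] _ rfl (by simp), zero_add]
    exact ih fun x y hxy hy => h _ _ (by simp [hxy]) hy

lemma splitSum_add (φ ψ : List α → List α → β) (a : List α) :
    splitSum (fun x y => φ x y + ψ x y) a = splitSum φ a + splitSum ψ a :=
  Finset.sum_add_distrib

lemma map_splitSum {G : Type*} [FunLike G β γ] [AddMonoidHomClass G β γ] (f : G)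
    (φ : List α → List α → β) (a : List α) :
    f (splitSum φ a) = splitSum (fun x y => f (φ x y)) a :=
  map_sum f _ _

lemma splitSum_map {α' : Type*} (e : α' → α) (φ : List α → List α → β) (a : List α') :
    splitSum φ (a.map e) = splitSum (fun x y => φ (x.map e) (y.map e)) a := by
  simp [splitSum, List.map_take, List.map_drop]

lemma splitSum_append_cons (φ : List α → List α → β) (p : List α) (c : α) (q : List α) :
    splitSum φ (p ++ c :: q) =
      splitSum (fun x y => φ x (y ++ c :: q)) p + splitSum (fun x y => φ (p ++ c :: x) y) q := by
  induction p generalizing φ with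
  | nil => simp [splitSum_cons]
  | cons b p ih => simp [splitSum_cons, ih, add_assoc]

lemma splitSum_assoc (φ : List α → List α → List α → β) (a : List α) :
    splitSum (fun u w => splitSum (φ u) w) a =
      splitSum (fun w z => splitSum (fun u v => φ u v z) w) a := by
  induction a generalizing φ with
  | nil => simp
  | cons x l ih =>
    rw [splitSum_cons, splitSum_cons, splitSum_cons, ih]
    simp only [splitSum_cons, splitSum_add, splitSum_nil, add_assoc]

lemma splitSum_comm {α' : Type*} (φ : List α → List α → List α' → List α' → β)
    (a : List α) (b : List α') :
    splitSum (fun x y => splitSum (fun u v => φ x y u v) b) a =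
      splitSum (fun u v => splitSum (fun x y => φ x y u v) a) b :=
  Finset.sum_comm

/-- The sum of `f (e p ++ b m :: q)` over all the ways of writing the list as `p ++ m ++ q`,
where `e` is applied entrywise: precomposition of `f` with the coderivation induced by `b`. -/
def insertSum (e : α → α) (b : List α → α) (f : List α → β) (a : List α) : β :=
  splitSum (fun p w => splitSum (fun m q => f (p.map e ++ b m :: q)) w) a

lemma map_insertSum {G : Type*} [FunLike G β γ] [AddMonoidHomClass G β γ] (g : G)
    (e : α → α) (b : List α → α) (f : List α → β) (a : List α) :
    g (insertSum e b f a) = insertSum e b (fun x => g (f x)) a := by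
  simp only [insertSum, map_splitSum]

lemma insertSum_mul {R : Type*} [NonUnitalNonAssocSemiring R] (e : α → α) (b : List α → α)
    (σ : R →+ R) (f g : List α → R) (a : List α) :
    insertSum e b (splitSum fun x y => σ (f x) * g y) a =
      splitSum (fun x y => σ (insertSum e b f x) * g y) a +
        splitSum (fun x y => σ (f (x.map e)) * insertSum e b g y) a := by
  have hl (x y : List α) : σ (insertSum e b f x) * g y = splitSum (fun p w =>
      splitSum (fun m q => σ (f (p.map e ++ b m :: q)) * g y) w) x := by
    rw [map_insertSum]
    exact (map_splitSum (AddMonoidHom.mulRight (g y)) _ _).trans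
      (splitSum_congr fun _ _ _ => map_splitSum (AddMonoidHom.mulRight (g y)) _ _)
  have hr (x y : List α) : σ (f (x.map e)) * insertSum e b g y = splitSum (fun p w =>
      splitSum (fun m q => σ (f (x.map e)) * g (p.map e ++ b m :: q)) w) y :=
    (map_splitSum (AddMonoidHom.mulLeft (σ (f (x.map e)))) _ _).trans
      (splitSum_congr fun _ _ _ => map_splitSum (AddMonoidHom.mulLeft (σ (f (x.map e)))) _ _)
  simp only [hl, hr, ← splitSum_assoc (fun p w y =>
    splitSum (fun m q => σ (f (p.map e ++ b m :: q)) * g y) w)]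
  rw [splitSum_assoc (fun x p w =>
    splitSum (fun m q => σ (f (x.map e)) * g (p.map e ++ b m :: q)) w), ← splitSum_add]
  refine splitSum_congr fun p w _ => ?_
  rw [splitSum_comm, ← splitSum_assoc (fun m q y => σ (f (p.map e ++ b m :: q)) * g y),
    ← splitSum_add]
  refine splitSum_congr fun m q _ => ?_
  rw [splitSum_append_cons, splitSum_map, add_comm]

lemma sum_range_sum_Icc_eq_splitSum (T : List α → List α → List α → β)
    (hT : ∀ p q, T p [] q = 0) (a : List α) :
    ∑ r ∈ Finset.range a.length, ∑ s ∈ Finset.Icc 1 (a.length - r),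
        T (a.take r) ((a.drop r).take s) (a.drop (r + s)) =
      splitSum (fun p w => splitSum (fun m q => T p m q) w) a := by
  unfold splitSum
  rw [Finset.sum_range_succ]
  simp only [List.drop_length, List.length_nil, zero_add, Finset.range_one,
    Finset.sum_singleton, List.take_nil, hT, add_zero, List.length_drop, List.drop_drop]
  refine Finset.sum_congr rfl fun r _ => Finset.sum_subset (fun s hs => ?_) fun s hs hs' => ?_
  · simp only [Finset.mem_Icc, Finset.mem_range] at *; omega
  · obtain rfl : s = 0 := by simp only [Finset.mem_Icc, Finset.mem_range] at *; omega
    simp [hT]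

lemma sum_Ioo_eq_splitSum (T : List α → List α → β) (hl : ∀ y, T [] y = 0)
    (hr : ∀ x, T x [] = 0) (a : List α) :
    ∑ s ∈ Finset.Ioo 0 a.length, T (a.take s) (a.drop s) = splitSum T a := by
  refine Finset.sum_subset (fun s hs => ?_) fun s hs hs' => ?_
  · simp only [Finset.mem_Ioo, Finset.mem_range] at *; omega
  · obtain rfl | rfl : s = 0 ∨ s = a.length := by
      simp only [Finset.mem_Ioo, Finset.mem_range] at *; omega
    · simp [hl]
    · simp [hr]

end SplitSum

/-! ### Signs -/

lemma gsign_eq_negOnePow (e : ℤ) : gsign e = e.negOnePow := by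
  unfold gsign
  split_ifs with h
  · simp [Int.negOnePow_even e h]
  · simp [Int.negOnePow_odd e (Int.not_even_iff_odd.mp h)]

lemma gsign_add (e f : ℤ) : gsign (e + f) = gsign e * gsign f := by
  simp [gsign_eq_negOnePow, Int.negOnePow_add]

lemma gsign_congr {e f : ℤ} (h : Even (e - f)) : gsign e = gsign f := by
  rw [gsign_eq_negOnePow, gsign_eq_negOnePow, (Int.negOnePow_eq_iff e f).mpr h]

lemma gsign_mul_self (e : ℤ) : gsign e * gsign e = 1 := by
  simp only [gsign]; split_ifs <;> simp

@[simp]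
lemma gsign_zero : gsign 0 = 1 := by simp [gsign]

lemma gsign_add_one (e : ℤ) : gsign (e + 1) = -gsign e := by
  simp [gsign_eq_negOnePow, Int.negOnePow_succ]

/-- The exponent `∑ (n - i) |aᵢ|` of the sign comparing `A_∞`-operations with their
suspensions. -/
def suspExp : List ℤ → ℤ
  | [] => 0
  | i :: l => l.length * i + suspExp l

lemma suspExp_append (l l' : List ℤ) :
    suspExp (l ++ l') = suspExp l + l'.length * l.sum + suspExp l' := by
  induction l with
  | nil => simp [suspExp]
  | cons i l ih =>
    simp only [List.cons_append, suspExp, List.length_append, ih, List.sum_cons]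
    push_cast
    ring

/-! ### Multilinear families of operations -/

variable (k) in
/-- `f` is multilinear in every arity. -/
structure IsListMultilinear (f : List A → A) : Prop where
  map_add : ∀ (p : List A) (u v : A) (q : List A),
    f (p ++ (u + v) :: q) = f (p ++ u :: q) + f (p ++ v :: q)
  map_smul : ∀ (p : List A) (c : k) (u : A) (q : List A),
    f (p ++ (c • u) :: q) = c • f (p ++ u :: q)

namespace IsListMultilinear

variable {f : List A → A}

lemma map_zero (hf : IsListMultilinear k f) (p q : List A) : f (p ++ 0 :: q) = 0 := by
  simpa using hf.map_smul p 0 0 q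

lemma map_gsign (hf : IsListMultilinear k f) (p : List A) (e : ℤ) (u : A) (q : List A) :
    f (p ++ (gsign e • u) :: q) = gsign e • f (p ++ u :: q) := by
  unfold gsign
  split_ifs
  · simp
  · simpa using hf.map_smul p (-1) u q

end IsListMultilinear

/-! ### Graded contractions and the tree formula -/

/-- A contraction of the dg-algebra `(𝒜, d)` onto its homology: `σ` is the grading involution,
`π` a projection onto a space of representing cycles and `h` a homotopy from `π` to the identity
satisfying the side conditions. -/
structure IsContraction (𝒜 : ℤ → Submodule k A) (d σ h π : A →ₗ[k] A) : Prop where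
  σ_apply : ∀ i, ∀ x ∈ 𝒜 i, σ x = gsign i • x
  h_mem : ∀ i, ∀ x ∈ 𝒜 i, h x ∈ 𝒜 (i - 1)
  π_mem : ∀ i, ∀ x ∈ 𝒜 i, π x ∈ 𝒜 i
  homotopy : ∀ x, d (h x) + h (d x) = x - π x
  h_h : ∀ x, h (h x) = 0
  h_π : ∀ x, h (π x) = 0
  π_h : ∀ x, π (h x) = 0
  π_d : ∀ x, π (d x) = 0
  d_π : ∀ x, d (π x) = 0
  π_π : ∀ x, π (π x) = π x
  π_one : π 1 = 1 ∨ π 1 = 0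

/-- The value of `π` on a list with one entry, and zero in the other arities. -/
def leafTerm (π : A →ₗ[k] A) : List A → A
  | [u] => π u
  | _ => 0

/-- Approximations to `treeMap`, correct in arity at most `n`. -/
def treeAux (σ h π : A →ₗ[k] A) : ℕ → List A → A
  | 0, _ => 0
  | n + 1, a =>
    leafTerm π a - h (splitSum (fun x y => σ (treeAux σ h π n x) * treeAux σ h π n y) a)

/-- The sum over planar binary trees with leaves labelled by `π`, internal edges and root labelled
by `-h` and vertices labelled by the suspended product `x, y ↦ σ x * y`. -/
def treeMap (σ h π : A →ₗ[k] A) (a : List A) : A :=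
  treeAux σ h π a.length a

/-- The sum of the suspended products `σ (treeMap x) * treeMap y` over all splittings
`x ++ y`. -/
def treeProd (σ h π : A →ₗ[k] A) (a : List A) : A :=
  splitSum (fun x y => σ (treeMap σ h π x) * treeMap σ h π y) a

/-- The suspended transferred operations. -/
def treeOps (σ h π : A →ₗ[k] A) (a : List A) : A :=
  π (treeProd σ h π a)

section Tree

variable (σ h π : A →ₗ[k] A)

lemma treeAux_nil (n : ℕ) : treeAux σ h π n [] = 0 := by
  induction n with
  | zero => rfl
  | succ n ih => simp [treeAux, ih, leafTerm]

lemma treeAux_succ_of_length_le (n : ℕ) (a : List A) (ha : a.length ≤ n) :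
    treeAux σ h π (n + 1) a = treeAux σ h π n a := by
  induction n generalizing a with
  | zero => rw [List.length_eq_zero_iff.mp (Nat.le_zero.mp ha), treeAux_nil, treeAux_nil]
  | succ n ih =>
    rw [treeAux, treeAux]
    congr 2
    refine splitSum_congr fun x y hxy => ?_
    have hlen := congrArg List.length hxy
    rw [List.length_append] at hlen
    by_cases hx : x = []
    · simp [hx, treeAux_nil]
    by_cases hy : y = []
    · simp [hy, treeAux_nil]
    have := List.length_pos_iff.mpr hx
    have := List.length_pos_iff.mpr hy
    rw [ih x (by omega), ih y (by omega)]

lemma treeAux_eq_treeMap (n : ℕ) (a : List A) (ha : a.length ≤ n) :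
    treeAux σ h π n a = treeMap σ h π a := by
  induction n, ha using Nat.le_induction with
  | base => rfl
  | succ n hn ih => rw [treeAux_succ_of_length_le _ _ _ _ _ hn, ih]

@[simp]
lemma treeMap_nil : treeMap σ h π [] = 0 := rfl

lemma treeMap_eq (a : List A) :
    treeMap σ h π a = leafTerm π a - h (treeProd σ h π a) := by
  rw [← treeAux_eq_treeMap σ h π _ a (Nat.le_succ _), treeAux, treeProd]
  congr 2
  refine splitSum_congr fun x y hxy => ?_
  have hlen := congrArg List.length hxy
  rw [List.length_append] at hlen
  rw [treeAux_eq_treeMap _ _ _ _ _ (by omega), treeAux_eq_treeMap _ _ _ _ _ (by omega)]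

@[simp]
lemma treeProd_nil : treeProd σ h π [] = 0 := by simp [treeProd]

@[simp]
lemma treeProd_singleton (u : A) : treeProd σ h π [u] = 0 := by
  simp [treeProd, splitSum_cons]

@[simp]
lemma treeMap_singleton (u : A) : treeMap σ h π [u] = π u := by
  simp [treeMap_eq, leafTerm]

lemma treeProd_pair (u v : A) : treeProd σ h π [u, v] = σ (π u) * π v := by
  simp [treeProd, splitSum_cons]

lemma leafTerm_isListMultilinear : IsListMultilinear k (leafTerm π) where
  map_add p u v q := by
    rcases p with _ | ⟨_, _ | _⟩ <;> rcases q with _ | _ <;> simp [leafTerm]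
  map_smul p c u q := by
    rcases p with _ | ⟨_, _ | _⟩ <;> rcases q with _ | _ <;> simp [leafTerm]

lemma IsListMultilinear.splitSum_mul {f : List A → A} (hf : IsListMultilinear k f) :
    IsListMultilinear k (splitSum fun x y => σ (f x) * f y) where
  map_add p u v q := by
    simp only [splitSum_append_cons, hf.map_add,
      _root_.map_add, mul_add, add_mul, splitSum_add]
    abel
  map_smul p c u q := by
    simp only [splitSum_append_cons, hf.map_smul,
      _root_.map_smul, mul_smul_comm, smul_mul_assoc, smul_add]
    exact congrArg₂ _ (map_splitSum (DistribSMul.toAddMonoidHom A c) _ _).symm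
      (map_splitSum (DistribSMul.toAddMonoidHom A c) _ _).symm

lemma treeAux_isListMultilinear (n : ℕ) : IsListMultilinear k (treeAux σ h π n) := by
  induction n with
  | zero => exact ⟨fun _ _ _ _ => by simp [treeAux], fun _ _ _ _ => by simp [treeAux]⟩
  | succ n ih =>
    have hl := leafTerm_isListMultilinear (k := k) π
    have hs := ih.splitSum_mul σ
    refine ⟨fun p u v q => ?_, fun p c u q => ?_⟩
    · simp only [treeAux, hl.map_add, hs.map_add, map_add]; abel
    · simp only [treeAux, hl.map_smul, hs.map_smul, map_smul, smul_sub]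

lemma treeMap_isListMultilinear : IsListMultilinear k (treeMap σ h π) where
  map_add p u v q := by
    simpa [treeMap] using (treeAux_isListMultilinear σ h π _).map_add p u v q
  map_smul p c u q := by
    simpa [treeMap] using (treeAux_isListMultilinear σ h π _).map_smul p c u q

lemma treeOps_isListMultilinear : IsListMultilinear k (treeOps σ h π) where
  map_add p u v q := by
    simp only [treeOps, treeProd,
      ((treeMap_isListMultilinear σ h π).splitSum_mul σ).map_add, map_add]
  map_smul p c u q := by
    simp only [treeOps, treeProd,
      ((treeMap_isListMultilinear σ h π).splitSum_mul σ).map_smul, map_smul]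

lemma insertSum_leafTerm (e : A → A) (b : List A → A) (a : List A) :
    insertSum e b (leafTerm π) a = π (b a) := by
  have hcons (x : A) (l : List A) (c : A) (q : List A) :
      leafTerm π (x :: (l ++ c :: q)) = 0 := by
    rcases l with _ | _ <;> rfl
  rw [insertSum, splitSum_eq_left, splitSum_eq_right]
  · rfl
  · intro x y _ hy
    obtain ⟨c, l, rfl⟩ := List.exists_cons_of_ne_nil hy
    exact hcons _ [] _ _
  · intro x y _ hx
    obtain ⟨c, l, rfl⟩ := List.exists_cons_of_ne_nil hx
    exact splitSum_eq_zero fun m q _ => hcons _ _ _ _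

end Tree

namespace IsContraction

variable {𝒜 : ℤ → Submodule k A} {d σ h π : A →ₗ[k] A}

section Map

lemma σ_mem (H : IsContraction 𝒜 d σ h π) {i : ℤ} {x : A} (hx : x ∈ 𝒜 i) : σ x ∈ 𝒜 i := by
  rw [H.σ_apply i x hx]
  exact zsmul_mem hx _

lemma σ_one [SetLike.GradedMonoid 𝒜] (H : IsContraction 𝒜 d σ h π) : σ 1 = 1 := by
  simp [H.σ_apply 0 1 SetLike.GradedOne.one_mem]

lemma treeMap_map_π (H : IsContraction 𝒜 d σ h π) (a : List A) :
    treeMap σ h π (a.map π) = treeMap σ h π a := by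
  have key (n : ℕ) (a : List A) : treeAux σ h π n (a.map π) = treeAux σ h π n a := by
    induction n generalizing a with
    | zero => rfl
    | succ n ih =>
      have hl : leafTerm π (a.map π) = leafTerm π a := by
        rcases a with _ | ⟨u, _ | _⟩ <;> simp [leafTerm, H.π_π]
      simp only [treeAux, hl, splitSum_map, ih]
  simp [treeMap, key]

lemma treeMap_congr (H : IsContraction 𝒜 d σ h π) {a b : List A} (hab : a.map π = b.map π) :
    treeMap σ h π a = treeMap σ h π b := by
  rw [← H.treeMap_map_π a, hab, H.treeMap_map_π]

lemma treeOps_congr (H : IsContraction 𝒜 d σ h π) {a b : List A} (hab : a.map π = b.map π) :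
    treeOps σ h π a = treeOps σ h π b := by
  have key (a : List A) : treeOps σ h π (a.map π) = treeOps σ h π a := by
    simp only [treeOps, treeProd, splitSum_map, H.treeMap_map_π]
  rw [← key a, hab, key]

lemma h_treeMap (H : IsContraction 𝒜 d σ h π) (a : List A) : h (treeMap σ h π a) = 0 := by
  rw [treeMap_eq, map_sub, H.h_h, sub_zero]
  rcases a with _ | ⟨u, _ | _⟩ <;> simp [leafTerm, H.h_π]

lemma π_treeMap (H : IsContraction 𝒜 d σ h π) {a : List A} (ha : a.length ≠ 1) :
    π (treeMap σ h π a) = 0 := by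
  rw [treeMap_eq, map_sub, H.π_h, sub_zero]
  rcases a with _ | ⟨u, _ | _⟩ <;> simp_all [leafTerm]

end Map

section Graded

variable [DirectSum.Decomposition 𝒜]

lemma linearMap_ext {B : Type*} [AddCommGroup B] [Module k B] {f g : A →ₗ[k] B}
    (hfg : ∀ i, ∀ x ∈ 𝒜 i, f x = g x) : f = g := by
  ext x
  induction x using DirectSum.Decomposition.inductionOn 𝒜 with
  | zero => simp
  | homogeneous x => exact hfg _ _ x.2
  | add x y hx hy => simp [hx, hy]

lemma σ_σ (H : IsContraction 𝒜 d σ h π) (x : A) : σ (σ x) = x := by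
  refine LinearMap.congr_fun (f := σ ∘ₗ σ) (g := LinearMap.id)
    (linearMap_ext (𝒜 := 𝒜) fun i x hx => ?_) x
  simp [H.σ_apply i x hx, smul_smul, gsign_mul_self, -zsmul_eq_mul]

lemma σ_π (H : IsContraction 𝒜 d σ h π) (x : A) : σ (π x) = π (σ x) := by
  refine LinearMap.congr_fun (f := σ ∘ₗ π) (g := π ∘ₗ σ)
    (linearMap_ext (𝒜 := 𝒜) fun i x hx => ?_) x
  simp [H.σ_apply i x hx, H.σ_apply i _ (H.π_mem i x hx), -zsmul_eq_mul]

lemma σ_h (H : IsContraction 𝒜 d σ h π) (x : A) : σ (h x) = -h (σ x) := by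
  refine LinearMap.congr_fun (f := σ ∘ₗ h) (g := -(h ∘ₗ σ))
    (linearMap_ext (𝒜 := 𝒜) fun i x hx => ?_) x
  have := gsign_add_one (i - 1)
  rw [sub_add_cancel] at this
  simp [H.σ_apply i x hx, H.σ_apply _ _ (H.h_mem i x hx), this, -zsmul_eq_mul]

lemma σ_d (H : IsContraction 𝒜 d σ h π) (hdg : IsDGAlgebra 𝒜 d) (x : A) :
    σ (d x) = -d (σ x) := by
  refine LinearMap.congr_fun (f := σ ∘ₗ d) (g := -(d ∘ₗ σ))
    (linearMap_ext (𝒜 := 𝒜) fun i x hx => ?_) x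
  simp [H.σ_apply i x hx, H.σ_apply _ _ (hdg.d_deg i x hx), gsign_add_one, -zsmul_eq_mul]

lemma d_mul (H : IsContraction 𝒜 d σ h π) (hdg : IsDGAlgebra 𝒜 d) (x y : A) :
    d (x * y) = d x * y + σ x * d y := by
  refine LinearMap.congr_fun (f := d ∘ₗ LinearMap.mulRight k y)
    (g := LinearMap.mulRight k y ∘ₗ d + LinearMap.mulRight k (d y) ∘ₗ σ)
    (linearMap_ext (𝒜 := 𝒜) fun i x hx => ?_) x
  simp [H.σ_apply i x hx, hdg.leibniz i x hx, -zsmul_eq_mul]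

lemma σ_mul [SetLike.GradedMonoid 𝒜] (H : IsContraction 𝒜 d σ h π) (x y : A) :
    σ (x * y) = σ x * σ y := by
  refine LinearMap.congr_fun (f := σ ∘ₗ LinearMap.mulRight k y)
    (g := LinearMap.mulRight k (σ y) ∘ₗ σ)
    (linearMap_ext (𝒜 := 𝒜) fun i x hx => ?_) x
  refine LinearMap.congr_fun (f := σ ∘ₗ LinearMap.mulLeft k x)
    (g := LinearMap.mulLeft k (σ x) ∘ₗ σ)
    (linearMap_ext (𝒜 := 𝒜) fun j y hy => ?_) y
  simp [H.σ_apply i x hx, H.σ_apply j y hy, H.σ_apply _ _ (SetLike.mul_mem_graded hx hy),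
    gsign_add, mul_smul, smul_comm (gsign i), -zsmul_eq_mul]

lemma treeMap_map_neg_σ [SetLike.GradedMonoid 𝒜] (H : IsContraction 𝒜 d σ h π) (a : List A) :
    treeMap σ h π (a.map (-σ)) = -σ (treeMap σ h π a) := by
  have key (n : ℕ) (a : List A) :
      treeAux σ h π n (a.map (-σ)) = -σ (treeAux σ h π n a) := by
    induction n generalizing a with
    | zero => simp [treeAux]
    | succ n ih =>
      have hl : leafTerm π (a.map (-σ)) = -σ (leafTerm π a) := by
        rcases a with _ | ⟨u, _ | _⟩ <;> simp [leafTerm, H.σ_π]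
      simp only [treeAux, hl, splitSum_map, ih, map_sub, H.σ_h, map_neg, neg_mul, mul_neg,
        neg_neg, ← H.σ_mul, ← map_splitSum σ]
      abel
  rw [treeMap, List.length_map, key, treeMap]

end Graded

section Unit

variable [SetLike.GradedMonoid 𝒜] [DirectSum.Decomposition 𝒜]

lemma treeProd_one_of_treeMap_one (H : IsContraction 𝒜 d σ h π) (hπ : π 1 = 1) (p q : List A)
    (hpq : 1 ≤ p.length + q.length)
    (ih : ∀ p' q' : List A, p'.length + q'.length < p.length + q.length →
      1 ≤ p'.length + q'.length → treeMap σ h π (p' ++ 1 :: q') = 0) :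
    h (treeProd σ h π (p ++ 1 :: q)) = 0 ∧
      (2 ≤ p.length + q.length → π (treeProd σ h π (p ++ 1 :: q)) = 0) := by
  have hone : treeMap σ h π [1] = 1 := by rw [treeMap_singleton, hπ]
  rcases eq_or_ne p [] with rfl | hp
  · have hq : treeProd σ h π ([] ++ 1 :: q) = treeMap σ h π q := by
      rw [treeProd, splitSum_append_cons, splitSum_nil, treeMap_nil, map_zero, zero_mul, zero_add,
        splitSum_eq_left]
      · rw [List.nil_append, hone, H.σ_one, one_mul]
      · intro x y hxy hx
        have hlen := congrArg List.length hxy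
        rw [List.length_append] at hlen
        by_cases hy : y = []
        · simp [hy]
        · have := List.length_pos_iff.mpr hx
          have := List.length_pos_iff.mpr hy
          rw [ih [] x (by simp; omega) (by simp; omega), map_zero, zero_mul]
    rw [hq]
    simp only [List.length_nil, zero_add]
    exact ⟨H.h_treeMap q, fun h2 => H.π_treeMap (by omega)⟩
  have hp' := List.length_pos_iff.mpr hp
  rcases eq_or_ne q [] with rfl | hq
  · have hp : treeProd σ h π (p ++ [1]) = σ (treeMap σ h π p) := by
      rw [treeProd, splitSum_append_cons, splitSum_nil, treeMap_nil, mul_zero, add_zero,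
        splitSum_eq_right]
      · rw [List.nil_append, hone, mul_one]
      · intro x y hxy hy
        have hlen := congrArg List.length hxy
        rw [List.length_append] at hlen
        by_cases hx : x = []
        · simp [hx]
        · have := List.length_pos_iff.mpr hx
          have := List.length_pos_iff.mpr hy
          rw [ih y [] (by simp; omega) (by simp; omega), mul_zero]
    rw [hp, ← H.σ_π, ← neg_eq_iff_eq_neg.mpr (H.σ_h _), H.h_treeMap]
    simp only [List.length_nil, add_zero, map_zero, neg_zero, true_and]
    exact fun h2 => by rw [H.π_treeMap (by omega), map_zero]
  have hq' := List.length_pos_iff.mpr hq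
  have hz : treeProd σ h π (p ++ 1 :: q) = 0 := by
    rw [treeProd, splitSum_append_cons, splitSum_eq_zero, splitSum_eq_zero, add_zero]
    · intro x y hxy
      have hlen := congrArg List.length hxy
      rw [List.length_append] at hlen
      by_cases hy : y = []
      · simp [hy]
      · have := List.length_pos_iff.mpr hy
        rw [ih p x (by omega) (by omega), map_zero, zero_mul]
    · intro x y hxy
      have hlen := congrArg List.length hxy
      rw [List.length_append] at hlen
      by_cases hx : x = []
      · simp [hx]
      · have := List.length_pos_iff.mpr hx
        rw [ih y q (by omega) (by omega), mul_zero]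
  simp [hz]

lemma treeMap_one (H : IsContraction 𝒜 d σ h π) (p q : List A) (hpq : 1 ≤ p.length + q.length) :
    treeMap σ h π (p ++ 1 :: q) = 0 := by
  rcases H.π_one with hπ | hπ
  · induction hn : p.length + q.length using Nat.strong_induction_on generalizing p q with
    | _ n ih =>
      subst hn
      rw [treeMap_eq, (H.treeProd_one_of_treeMap_one hπ p q hpq
        fun p' q' hlt hle => ih _ hlt p' q' hle rfl).1, sub_zero]
      rcases p with _ | ⟨_, _ | _⟩ <;> rcases q with _ | _ <;> simp_all [leafTerm]
  · rw [H.treeMap_congr (b := p ++ 0 :: q) (by simp [hπ])]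
    exact (treeMap_isListMultilinear σ h π).map_zero p q

lemma treeOps_one (H : IsContraction 𝒜 d σ h π) (p q : List A) (hpq : 2 ≤ p.length + q.length) :
    treeOps σ h π (p ++ 1 :: q) = 0 := by
  rcases H.π_one with hπ | hπ
  · exact (H.treeProd_one_of_treeMap_one hπ p q (by omega)
      fun p' q' _ hle => H.treeMap_one p' q' hle).2 hpq
  · rw [H.treeOps_congr (b := p ++ 0 :: q) (by simp [hπ])]
    exact (treeOps_isListMultilinear σ h π).map_zero p q

end Unit

section Degree

variable [SetLike.GradedMonoid 𝒜]

lemma splitSum_mul_mem (H : IsContraction 𝒜 d σ h π) {f : List A → A}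
    (hf : ∀ (ds : List ℤ) (a : List A), IsHomogeneousList 𝒜 ds a →
      f a ∈ 𝒜 (ds.sum + 1 - a.length))
    (ds : List ℤ) (a : List A) (ha : IsHomogeneousList 𝒜 ds a) :
    splitSum (fun x y => σ (f x) * f y) a ∈ 𝒜 (ds.sum + 2 - a.length) := by
  refine sum_mem fun s hs => ?_
  have hx := H.σ_mem (hf _ _ (List.forall₂_take s ha))
  have hy := hf _ _ (List.forall₂_drop s ha)
  have hsum := List.sum_take_add_sum_drop ds s
  have hlen := congrArg List.length (List.take_append_drop s a)
  rw [List.length_append] at hlen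
  convert SetLike.mul_mem_graded hx hy using 2
  zify at hlen
  linarith

lemma treeMap_mem (H : IsContraction 𝒜 d σ h π) (ds : List ℤ) (a : List A)
    (ha : IsHomogeneousList 𝒜 ds a) : treeMap σ h π a ∈ 𝒜 (ds.sum + 1 - a.length) := by
  have key (n : ℕ) (ds : List ℤ) (a : List A) (ha : IsHomogeneousList 𝒜 ds a) :
      treeAux σ h π n a ∈ 𝒜 (ds.sum + 1 - a.length) := by
    induction n generalizing ds a with
    | zero => exact zero_mem _
    | succ n ih =>
      refine sub_mem ?_ ?_
      · rcases ha with _ | ⟨hu, _ | _⟩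
        · exact zero_mem _
        · simpa [leafTerm] using H.π_mem _ _ hu
        · exact zero_mem _
      · convert H.h_mem _ _ (H.splitSum_mul_mem ih ds a ha) using 2
        ring
  exact key _ ds a ha

lemma treeOps_mem (H : IsContraction 𝒜 d σ h π) (ds : List ℤ) (a : List A)
    (ha : IsHomogeneousList 𝒜 ds a) : treeOps σ h π a ∈ 𝒜 (ds.sum + 2 - a.length) :=
  H.π_mem _ _ (H.splitSum_mul_mem H.treeMap_mem ds a ha)

end Degree

section Relations

variable [SetLike.GradedMonoid 𝒜] [DirectSum.Decomposition 𝒜]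

lemma d_treeProd_of_d_treeMap (H : IsContraction 𝒜 d σ h π) (hdg : IsDGAlgebra 𝒜 d) (a : List A)
    (ih : ∀ x : List A, x.length < a.length → d (treeMap σ h π x) =
      -treeProd σ h π x + insertSum (-σ) (treeOps σ h π) (treeMap σ h π) x) :
    d (treeProd σ h π a) =
      -insertSum (-σ) (treeOps σ h π) (treeProd σ h π) a := by
  set G := treeMap σ h π with hG
  set Q := treeProd σ h π with hQ
  set I := insertSum (-σ) (treeOps σ h π) G with hI
  have hQdef : Q = splitSum fun x y => σ (G x) * G y := rfl
  have hsplit : d (Q a) + (splitSum (fun x y => σ (I x) * G y) a +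
      splitSum (fun x y => σ (G (x.map (-σ))) * I y) a) +
      splitSum (fun x y => G x * Q y) a = splitSum (fun x y => σ (Q x) * G y) a := by
    have hd : d (Q a) = splitSum (fun x y => d (σ (G x) * G y)) a := map_splitSum d _ _
    rw [hd, ← splitSum_add, ← splitSum_add, ← splitSum_add]
    refine splitSum_congr fun x y hxy => ?_
    have hlen := congrArg List.length hxy
    rw [List.length_append] at hlen
    have hl : σ (d (G x)) * G y = σ (-Q x + I x) * G y := by
      by_cases hy : y = []
      · simp [hy, hG]
      · have := List.length_pos_iff.mpr hy
        rw [ih x (by omega)]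
    have hr : G x * d (G y) = G x * (-Q y + I y) := by
      by_cases hx : x = []
      · simp [hx, hG]
      · have := List.length_pos_iff.mpr hx
        rw [ih y (by omega)]
    have hε : σ (G (x.map (-σ))) = -G x := by rw [hG, H.treeMap_map_neg_σ, map_neg, H.σ_σ]
    rw [H.d_mul hdg, H.σ_σ, hr, ← neg_eq_iff_eq_neg.mpr (H.σ_d hdg (G x)), neg_mul, hl,
      hε, map_add, map_neg]
    noncomm_ring
  have hassoc : splitSum (fun x y => G x * Q y) a = splitSum (fun x y => σ (Q x) * G y) a := by
    have hl (x y : List A) : G x * Q y = splitSum (fun u v => G x * (σ (G u) * G v)) y :=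
      map_splitSum (AddMonoidHom.mulLeft (G x)) _ _
    have hr (x y : List A) : σ (Q x) * G y = splitSum (fun u v => G u * (σ (G v) * G y)) x := by
      rw [hQdef, map_splitSum]
      refine (map_splitSum (AddMonoidHom.mulRight (G y)) _ _).trans
        (splitSum_congr fun u v _ => ?_)
      simp [H.σ_mul, H.σ_σ, mul_assoc]
    simp only [hl, hr]
    exact splitSum_assoc (fun x u v => G x * (σ (G u) * G v)) a
  have hins : insertSum (-σ) (treeOps σ h π) Q a = splitSum (fun x y => σ (I x) * G y) a +
      splitSum (fun x y => σ (G (x.map (-σ))) * I y) a :=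
    insertSum_mul (-σ) (treeOps σ h π) σ.toAddMonoidHom G G a
  rw [hassoc] at hsplit
  rw [hins, eq_neg_iff_add_eq_zero]
  exact add_eq_right.mp hsplit

/-- The suspended form of the identities for an `A_∞`-morphism to a dg-algebra. -/
lemma d_treeMap (H : IsContraction 𝒜 d σ h π) (hdg : IsDGAlgebra 𝒜 d) (a : List A) :
    d (treeMap σ h π a) =
      -treeProd σ h π a + insertSum (-σ) (treeOps σ h π) (treeMap σ h π) a := by
  induction hn : a.length using Nat.strong_induction_on generalizing a with
  | _ n ih =>
    subst hn
    have hdQ := H.d_treeProd_of_d_treeMap hdg a fun x hx => ih _ hx x rfl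
    have hleaf : d (leafTerm π a) = 0 := by
      rcases a with _ | ⟨u, _ | _⟩ <;> simp [leafTerm, H.d_π]
    have hins : insertSum (-σ) (treeOps σ h π) (treeMap σ h π) a =
        π (treeProd σ h π a) - h (insertSum (-σ) (treeOps σ h π) (treeProd σ h π) a) := by
      rw [map_insertSum h, eq_sub_iff_add_eq]
      simp only [insertSum, ← splitSum_add]
      simp only [treeMap_eq, sub_add_cancel]
      rw [← H.π_π]
      exact insertSum_leafTerm π _ _ a
    have hhom := H.homotopy (treeProd σ h π a)
    rw [hdQ, map_neg, ← sub_eq_add_neg, sub_eq_iff_eq_add] at hhom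
    rw [treeMap_eq, map_sub, hleaf, hhom, hins]
    abel

lemma d_treeProd (H : IsContraction 𝒜 d σ h π) (hdg : IsDGAlgebra 𝒜 d) (a : List A) :
    d (treeProd σ h π a) = -insertSum (-σ) (treeOps σ h π) (treeProd σ h π) a :=
  H.d_treeProd_of_d_treeMap hdg a fun x _ => H.d_treeMap hdg x

/-- The suspended form of the Stasheff identities. -/
lemma insertSum_treeOps (H : IsContraction 𝒜 d σ h π) (hdg : IsDGAlgebra 𝒜 d) (a : List A) :
    insertSum (-σ) (treeOps σ h π) (treeOps σ h π) a = 0 := by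
  have hdQ := congrArg π (H.d_treeProd hdg a)
  rw [H.π_d, map_neg, map_insertSum, eq_comm, neg_eq_zero] at hdQ
  exact hdQ

end Relations

end IsContraction

/-! ### Desuspension -/

/-- The twist `a₁, …, aₙ ↦ σⁿ⁻¹ a₁, …, σ aₙ₋₁, aₙ`. -/
def suspTwist (σ : A →ₗ[k] A) : List A → List A
  | [] => []
  | x :: l => (σ ^ l.length : Module.End k A) x :: suspTwist σ l

section Twist

variable (σ : A →ₗ[k] A)

@[simp]
lemma length_suspTwist (a : List A) : (suspTwist σ a).length = a.length := by
  induction a with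
  | nil => rfl
  | cons x l ih => simp [suspTwist, ih]

lemma exists_suspTwist_append_cons (p q : List A) :
    ∃ p' : List A, p'.length = p.length ∧ ∀ c, suspTwist σ (p ++ c :: q) =
      p' ++ (σ ^ q.length : Module.End k A) c :: suspTwist σ q := by
  induction p with
  | nil => exact ⟨[], rfl, fun c => rfl⟩
  | cons x p ih =>
    obtain ⟨p', hlen, h⟩ := ih
    exact ⟨(σ ^ (p.length + (q.length + 1)) : Module.End k A) x :: p', by simp [hlen],
      fun c => by simp [suspTwist, h]⟩

lemma IsListMultilinear.comp_suspTwist {f : List A → A} (hf : IsListMultilinear k f) :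
    IsListMultilinear k fun a => f (suspTwist σ a) where
  map_add p u v q := by
    obtain ⟨p', -, h⟩ := exists_suspTwist_append_cons σ p q
    simp only [h, _root_.map_add, hf.map_add]
  map_smul p c u q := by
    obtain ⟨p', -, h⟩ := exists_suspTwist_append_cons σ p q
    simp only [h, _root_.map_smul, hf.map_smul]

lemma IsListMultilinear.encodesFamily {f : List A → A} (hf : IsListMultilinear k f)
    (d : A →ₗ[k] A) (hcongr : ∀ a b, HomologyEquiv d a b → f a = f b) (N : ℕ) :
    EncodesFamily d f N where
  congr a b _ hab := hcongr a b hab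
  map_add p u v q _ _ _ _ _ := hf.map_add p u v q
  map_smul p c u q _ _ _ _ := hf.map_smul p c u q

end Twist

namespace IsContraction

variable {𝒜 : ℤ → Submodule k A} {d σ h π : A →ₗ[k] A}

lemma σ_pow_apply (H : IsContraction 𝒜 d σ h π) (n : ℕ) {i : ℤ} {x : A} (hx : x ∈ 𝒜 i) :
    (σ ^ n : Module.End k A) x = gsign (n * i) • x := by
  induction n with
  | zero => simp
  | succ n ih =>
    rw [pow_succ', Module.End.mul_apply, ih, map_zsmul, H.σ_apply i x hx, smul_smul, ← gsign_add]
    push_cast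
    ring_nf

lemma isHomogeneousList_suspTwist (H : IsContraction 𝒜 d σ h π) {ds : List ℤ} {a : List A}
    (ha : IsHomogeneousList 𝒜 ds a) : IsHomogeneousList 𝒜 ds (suspTwist σ a) := by
  induction ha with
  | nil => exact .nil
  | cons hx _ ih =>
    refine .cons ?_ ih
    rw [H.σ_pow_apply _ hx]
    exact zsmul_mem hx _

lemma map_π_suspTwist [DirectSum.Decomposition 𝒜] (H : IsContraction 𝒜 d σ h π) (a : List A) :
    (suspTwist σ a).map π = suspTwist σ (a.map π) := by
  have hpow (n : ℕ) (x : A) :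
      π ((σ ^ n : Module.End k A) x) = (σ ^ n : Module.End k A) (π x) := by
    induction n with
    | zero => rfl
    | succ n ih => simp only [pow_succ', Module.End.mul_apply, ← H.σ_π, ih]
  induction a with
  | nil => rfl
  | cons x l ih => simp [suspTwist, ih, hpow]

lemma map_π_eq_of_homologyEquiv (H : IsContraction 𝒜 d σ h π) {a b : List A}
    (hab : HomologyEquiv d a b) : a.map π = b.map π := by
  induction hab with
  | nil => rfl
  | cons hxy _ ih =>
    obtain ⟨_, _, z, hz⟩ := hxy
    rw [List.map_cons, List.map_cons, ih, sub_eq_zero.mp ((map_sub π _ _).symm.trans _)]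
    rw [← hz, H.π_d]

lemma apply_suspTwist (H : IsContraction 𝒜 d σ h π) {f : List A → A}
    (hf : IsListMultilinear k f) {ds : List ℤ} {a : List A} (ha : IsHomogeneousList 𝒜 ds a) :
    f (suspTwist σ a) = gsign (suspExp ds) • f a := by
  suffices key : ∀ p, f (p ++ suspTwist σ a) = gsign (suspExp ds) • f (p ++ a) from key []
  induction ha with
  | nil => simp [suspTwist, suspExp]
  | @cons x i l ds hx hl ih =>
    intro p
    have := ih (p ++ [(σ ^ l.length : Module.End k A) x])
    rw [List.append_assoc, List.append_assoc] at this
    rw [suspTwist, suspExp]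
    refine this.trans ?_
    rw [List.singleton_append, H.σ_pow_apply _ hx, hf.map_gsign, smul_smul, ← gsign_add,
      hl.length_eq, add_comm]

lemma apply_map_neg_σ (H : IsContraction 𝒜 d σ h π) {f : List A → A}
    (hf : IsListMultilinear k f) {ds : List ℤ} {a : List A} (ha : IsHomogeneousList 𝒜 ds a)
    (q : List A) :
    f (a.map (-σ) ++ q) = gsign (ds.sum + a.length) • f (a ++ q) := by
  suffices key : ∀ p, f (p ++ (a.map (-σ) ++ q)) =
    gsign (ds.sum + a.length) • f (p ++ (a ++ q)) from key []
  induction ha with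
  | nil => simp
  | @cons x i l ds hx hl ih =>
    intro p
    have := ih (p ++ [(-σ) x])
    rw [List.append_assoc, List.append_assoc] at this
    refine this.trans ?_
    have hε : (-σ) x = gsign (i + 1) • x := by
      rw [LinearMap.neg_apply, H.σ_apply i x hx, gsign_add_one, neg_smul]
    rw [List.singleton_append, hε, hf.map_gsign, smul_smul, ← gsign_add, List.sum_cons,
      List.length_cons, List.cons_append]
    congr 2
    push_cast
    ring

lemma desuspended_term [SetLike.GradedMonoid 𝒜] (H : IsContraction 𝒜 d σ h π) {f : List A → A}
    (hf : IsListMultilinear k f) {dp dm dq : List ℤ} {p m q : List A}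
    (hp : IsHomogeneousList 𝒜 dp p) (hm : IsHomogeneousList 𝒜 dm m)
    (hq : IsHomogeneousList 𝒜 dq q) :
    gsign ((p.length : ℤ) + m.length * q.length + m.length * dp.sum) •
        f (suspTwist σ (p ++ treeOps σ h π (suspTwist σ m) :: q)) =
      gsign (suspExp (dp ++ dm ++ dq)) • f (p.map (-σ) ++ treeOps σ h π m :: q) := by
  have hc := H.treeOps_mem _ _ (H.isHomogeneousList_suspTwist hm)
  rw [length_suspTwist] at hc
  rw [H.apply_suspTwist hf (List.rel_append hp (.cons hc hq)), H.apply_map_neg_σ hf hp,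
    H.apply_suspTwist (treeOps_isListMultilinear σ h π) hm, hf.map_gsign, smul_smul, smul_smul,
    smul_smul, ← gsign_add, ← gsign_add, ← gsign_add]
  congr 1
  refine gsign_congr ⟨q.length, ?_⟩
  simp only [suspExp_append, suspExp, List.sum_append, List.length_cons, hp.length_eq,
    hm.length_eq, hq.length_eq]
  push_cast
  ring

lemma sum_desuspended_terms [SetLike.GradedMonoid 𝒜] (H : IsContraction 𝒜 d σ h π)
    {f : List A → A} (hf : IsListMultilinear k f) {ds : List ℤ} {a : List A}
    (ha : IsHomogeneousList 𝒜 ds a) :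
    ∑ r ∈ Finset.range a.length, ∑ s ∈ Finset.Icc 1 (a.length - r),
      gsign ((r : ℤ) + (s : ℤ) * ((a.length : ℤ) - (r : ℤ) - (s : ℤ)) +
          (s : ℤ) * (ds.take r).sum) •
        f (suspTwist σ (a.take r ++ treeOps σ h π (suspTwist σ ((a.drop r).take s)) ::
          a.drop (r + s))) =
      gsign (suspExp ds) • insertSum (-σ) (treeOps σ h π) f a := by
  have hT (p q : List A) : f (p.map (-σ) ++ treeOps σ h π [] :: q) = 0 := by
    rw [treeOps, treeProd_nil, map_zero, hf.map_zero]
  rw [insertSum, ← sum_range_sum_Icc_eq_splitSum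
    (fun p m q => f (p.map (-σ) ++ treeOps σ h π m :: q)) hT, Finset.smul_sum]
  refine Finset.sum_congr rfl fun r hr => ?_
  rw [Finset.smul_sum]
  refine Finset.sum_congr rfl fun s hs => ?_
  rw [Finset.mem_range] at hr
  rw [Finset.mem_Icc] at hs
  have key := H.desuspended_term hf (List.forall₂_take r ha)
    (List.forall₂_take s (List.forall₂_drop r ha)) (List.forall₂_drop (r + s) ha)
  have hds : ds.take r ++ (ds.drop r).take s ++ ds.drop (r + s) = ds := by
    rw [List.append_assoc, ← List.drop_drop, List.take_append_drop, List.take_append_drop]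
  rw [hds] at key
  rw [← key]
  congr 2
  simp only [List.length_take, List.length_drop]
  rw [min_eq_left (by omega), min_eq_left (by omega)]
  push_cast [show r + s ≤ a.length by omega]
  ring

end IsContraction

/-! ### Compositions with at most two blocks -/

lemma dgOps_eq_zero (d : A →ₗ[k] A) (l : List A) (h1 : l.length ≠ 1) (h2 : l.length ≠ 2) :
    dgOps d l = 0 := by
  rcases l with _ | ⟨_, _ | ⟨_, _ | _⟩⟩ <;> simp_all [dgOps]

lemma splitWrtComposition_pair {α : Type*} (l : List α) {n : ℕ} (hl : l.length = n)
    (c : Composition n) {s t : ℕ} (hc : c.blocks = [s, t]) :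
    l.splitWrtComposition c = [l.take s, l.drop s] := by
  have hsum := c.blocks_sum
  rw [hc] at hsum
  simp only [List.sum_cons, List.sum_nil, add_zero] at hsum
  simp only [List.splitWrtComposition, hc, List.splitWrtCompositionAux, List.splitAt_eq]
  rw [List.take_of_length_le (i := t) (by simp; omega)]

/-- The composition `s + (n - s)` of `n`. -/
def pairComposition (n s : ℕ) (h0 : 0 < s) (hn : s < n) : Composition n where
  blocks := [s, n - s]
  blocks_pos := by
    intro i hi
    simp only [List.mem_cons, List.not_mem_nil, or_false] at hi
    omega
  blocks_sum := by simp; omega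

lemma sum_composition_of_length_le_two {β : Type*} [AddCommMonoid β] {n : ℕ} (hn : 0 < n)
    (T : Composition n → β) (hT : ∀ c : Composition n, c.length ≠ 1 → c.length ≠ 2 → T c = 0)
    (S : ℕ → β) (hS : ∀ s (h0 : 0 < s) (hs : s < n), T (pairComposition n s h0 hs) = S s) :
    ∑ c, T c = T (Composition.single n hn) + ∑ s ∈ Finset.Ioo 0 n, S s := by
  classical
  rw [← Finset.add_sum_erase _ T (Finset.mem_univ (Composition.single n hn))]
  congr 1
  have hsub : Finset.univ.filter (fun c : Composition n => c.length = 2) ⊆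
      Finset.univ.erase (Composition.single n hn) := by
    intro c hc
    have hc := (Finset.mem_filter.mp hc).2
    rw [Finset.mem_erase, Ne, Composition.eq_single_iff_length hn]
    exact ⟨by omega, Finset.mem_univ _⟩
  rw [← Finset.sum_subset hsub]
  · symm
    refine Finset.sum_bij (fun s hs => pairComposition n s (Finset.mem_Ioo.mp hs).1
      (Finset.mem_Ioo.mp hs).2) (fun s hs => ?_) (fun s hs t ht hst => ?_) (fun c hc => ?_)
      fun s hs => (hS s _ _).symm
    · simp [pairComposition, Composition.length]
    · exact (List.cons.inj (congrArg Composition.blocks hst)).1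
    · obtain ⟨s, t, hst⟩ := List.length_eq_two.mp (Finset.mem_filter.mp hc).2
      have hsum := c.blocks_sum
      have hs : 0 < s := c.blocks_pos (by simp [hst])
      have ht : 0 < t := c.blocks_pos (by simp [hst])
      rw [hst] at hsum
      simp only [List.sum_cons, List.sum_nil, add_zero] at hsum
      refine ⟨s, Finset.mem_Ioo.mpr ⟨hs, by omega⟩, Composition.ext ?_⟩
      simp only [pairComposition, hst, ← hsum, Nat.add_sub_cancel_left]
  · intro c hc hc'
    rw [Finset.mem_erase, Ne, Composition.eq_single_iff_length hn] at hc
    exact hT c hc.1 (by simpa using hc')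

lemma morphismRHS_eq (d : A →ₗ[k] A) (F : List A → A) (hF : F [] = 0) (ds : List ℤ) (a : List A)
    (hlen : ds.length = a.length) :
    MorphismRHS d F ds a = d (F a) + ∑ s ∈ Finset.Ioo 0 a.length,
      gsign ((s : ℤ) - 1 + (1 - ((a.length : ℤ) - s)) * (ds.take s).sum) •
        (F (a.take s) * F (a.drop s)) := by
  have hT (c : Composition a.length) (h1 : c.length ≠ 1) (h2 : c.length ≠ 2) :
      gsign (wExp c.blocks + koszulExp (ds.splitWrtComposition c)) •
        dgOps d ((a.splitWrtComposition c).map F) = 0 := by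
    rw [dgOps_eq_zero, smul_zero] <;>
      rwa [List.length_map, List.length_splitWrtComposition]
  rcases Nat.eq_zero_or_pos a.length with h0 | hpos
  · obtain rfl := List.length_eq_zero_iff.mp h0
    rw [MorphismRHS, Finset.sum_eq_zero fun c _ => hT c ?_ ?_]
    · simp [hF]
    all_goals have := c.length_le; simp only [List.length_nil] at this; omega
  rw [MorphismRHS, sum_composition_of_length_le_two hpos _ hT (fun s =>
      gsign ((s : ℤ) - 1 + (1 - ((a.length : ℤ) - s)) * (ds.take s).sum) •
        (F (a.take s) * F (a.drop s)))]
  · congr 1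
    have hd : ds.splitWrtComposition (Composition.single a.length hpos) = [ds] := by
      simp [List.splitWrtComposition, List.splitWrtCompositionAux, ← hlen]
    have ha : a.splitWrtComposition (Composition.single a.length hpos) = [a] := by
      simp [List.splitWrtComposition, List.splitWrtCompositionAux]
    rw [hd, ha]
    simp [wExp, koszulExp, dgOps]
  · intro s h0 hs
    rw [splitWrtComposition_pair ds hlen _ rfl, splitWrtComposition_pair a rfl _ rfl]
    simp only [List.map_cons, List.map_nil, dgOps]
    congr 2
    simp [wExp, koszulExp, pairComposition, Finset.sum_range_succ, hlen, Nat.cast_sub hs.le]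

namespace IsContraction

variable {𝒜 : ℤ → Submodule k A} {d σ h π : A →ₗ[k] A} [SetLike.GradedMonoid 𝒜]

lemma sum_desuspended_products (H : IsContraction 𝒜 d σ h π) {ds : List ℤ} {a : List A}
    (ha : IsHomogeneousList 𝒜 ds a) :
    ∑ s ∈ Finset.Ioo 0 a.length,
      gsign ((s : ℤ) - 1 + (1 - ((a.length : ℤ) - s)) * (ds.take s).sum) •
        (treeMap σ h π (suspTwist σ (a.take s)) * treeMap σ h π (suspTwist σ (a.drop s))) =
      gsign (suspExp ds) • treeProd σ h π a := by
  rw [treeProd, ← sum_Ioo_eq_splitSum _ (by simp) (by simp), Finset.smul_sum]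
  refine Finset.sum_congr rfl fun s hs => ?_
  rw [Finset.mem_Ioo] at hs
  have hx := List.forall₂_take s ha
  have hy := List.forall₂_drop s ha
  have hG := treeMap_isListMultilinear σ h π
  rw [H.apply_suspTwist hG hx, H.apply_suspTwist hG hy, H.σ_apply _ _ (H.treeMap_mem _ _ hx)]
  simp only [smul_mul_assoc, mul_smul_comm, smul_smul, ← gsign_add]
  congr 1
  have hexp := suspExp_append (ds.take s) (ds.drop s)
  rw [List.take_append_drop] at hexp
  rw [← sub_add_cancel (suspExp ds) (suspExp ds), hexp]
  have hl : (List.take s a).length = s := by simp; omega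
  have hr : ((List.drop s ds).length : ℤ) = a.length - s := by
    rw [List.length_drop, ← ha.length_eq, Nat.cast_sub hs.2.le]
  rw [hl, hr]
  refine gsign_congr ⟨s - 1 - ((a.length : ℤ) - s) * (ds.take s).sum, ?_⟩
  ring

variable [DirectSum.Decomposition 𝒜]

lemma satisfiesStasheff (H : IsContraction 𝒜 d σ h π) (hdg : IsDGAlgebra 𝒜 d) (N : ℕ) :
    SatisfiesStasheff d 𝒜 (fun a => treeOps σ h π (suspTwist σ a)) N := by
  intro ds a _ _ ha
  rw [StasheffSum, H.sum_desuspended_terms (treeOps_isListMultilinear σ h π) ha,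
    H.insertSum_treeOps hdg, smul_zero]
  exact zero_mem _

lemma satisfiesStasheffMorph (H : IsContraction 𝒜 d σ h π) (hdg : IsDGAlgebra 𝒜 d) (N : ℕ) :
    SatisfiesStasheffMorph d 𝒜 (fun a => treeMap σ h π (suspTwist σ a))
      (fun a => treeOps σ h π (suspTwist σ a)) N := by
  intro ds a _ _ ha
  have hG := treeMap_isListMultilinear σ h π
  rw [MorphismLHS, H.sum_desuspended_terms hG ha, morphismRHS_eq d _ rfl ds a ha.length_eq.symm,
    H.sum_desuspended_products ha, H.apply_suspTwist hG ha, map_zsmul, ← smul_add,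
    H.d_treeMap hdg, neg_add_cancel_comm]

end IsContraction

/-! ### Existence of contractions -/

section Existence

variable (𝒜 : ℤ → Submodule k A) [DirectSum.Decomposition 𝒜]

/-- The linear map given on the homogeneous component of degree `i` by `f i`. -/
def ofComponents (f : ℤ → A →ₗ[k] A) : A →ₗ[k] A :=
  DirectSum.toModule k ℤ A (fun i => f i ∘ₗ (𝒜 i).subtype) ∘ₗ
    (DirectSum.decomposeLinearEquiv 𝒜).toLinearMap

lemma ofComponents_apply (f : ℤ → A →ₗ[k] A) {i : ℤ} {x : A} (hx : x ∈ 𝒜 i) :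
    ofComponents 𝒜 f x = f i x := by
  lift x to 𝒜 i using hx
  simp [ofComponents]

variable {𝒜} {d : A →ₗ[k] A}

lemma exists_pseudoInverse (d : A →ₗ[k] A) :
    ∃ g : A →ₗ[k] A, (∀ x, d (g (d x)) = d x) ∧ (1 ∈ LinearMap.range d ∨ g 1 = 0) := by
  obtain ⟨g₀, hg₀⟩ := d.rangeRestrict.exists_rightInverse_of_surjective d.range_rangeRestrict
  obtain ⟨g, hg⟩ := g₀.exists_extend
  have hgd (x : A) : d (g (d x)) = d x := by
    have h1 : g (d x) = g₀ (d.rangeRestrict x) := LinearMap.congr_fun hg (d.rangeRestrict x)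
    have h2 : d (g₀ (d.rangeRestrict x)) = d x :=
      congrArg Subtype.val (LinearMap.congr_fun hg₀ (d.rangeRestrict x))
    rw [h1, h2]
  by_cases hone : (1 : A) ∈ LinearMap.range d
  · exact ⟨g, hgd, .inl hone⟩
  · obtain ⟨ℓ, hℓ, hle⟩ := Submodule.exists_le_ker_of_notMem hone
    refine ⟨g - (ℓ 1)⁻¹ • ℓ.smulRight (g 1), fun x => ?_, .inr ?_⟩
    · have : ℓ (d x) = 0 := hle ⟨x, rfl⟩
      simp [this, hgd]
    · simp [smul_smul, inv_mul_cancel₀ hℓ]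

lemma exists_graded_pseudoInverse [SetLike.GradedMonoid 𝒜] (hdg : IsDGAlgebra 𝒜 d) :
    ∃ g : A →ₗ[k] A, (∀ i, ∀ x ∈ 𝒜 i, g x ∈ 𝒜 (i - 1)) ∧ (∀ x, d (g (d x)) = d x) ∧
      (1 ∈ LinearMap.range d ∨ g 1 = 0) := by
  obtain ⟨g, hg, hone⟩ := exists_pseudoInverse d
  let proj (i : ℤ) : A →ₗ[k] A :=
    (𝒜 i).subtype ∘ₗ DirectSum.component k ℤ (fun i => 𝒜 i) i ∘ₗ
      (DirectSum.decomposeLinearEquiv 𝒜).toLinearMap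
  have hproj (i : ℤ) (x : A) : proj i x = DirectSum.decompose 𝒜 x i := rfl
  have hproj_d (i : ℤ) (x : A) : d (proj i x) = proj (i + 1) (d x) := by
    refine LinearMap.congr_fun (f := d ∘ₗ proj i) (g := proj (i + 1) ∘ₗ d)
      (IsContraction.linearMap_ext (𝒜 := 𝒜) fun j x hx => ?_) x
    simp only [LinearMap.comp_apply, hproj]
    by_cases hij : j = i
    · subst hij
      rw [DirectSum.decompose_of_mem_same 𝒜 hx,
        DirectSum.decompose_of_mem_same 𝒜 (hdg.d_deg _ _ hx)]
    · rw [DirectSum.decompose_of_mem_ne 𝒜 hx hij,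
        DirectSum.decompose_of_mem_ne 𝒜 (hdg.d_deg _ _ hx) (by omega), map_zero]
  have happly {i : ℤ} {x : A} (hx : x ∈ 𝒜 i) :
      ofComponents 𝒜 (fun i => proj (i - 1) ∘ₗ g) x = proj (i - 1) (g x) :=
    ofComponents_apply 𝒜 _ hx
  refine ⟨ofComponents 𝒜 fun i => proj (i - 1) ∘ₗ g, fun i x hx => ?_, fun x => ?_,
    hone.imp_right fun h1 => ?_⟩
  · rw [happly hx, hproj]
    exact SetLike.coe_mem _
  · refine LinearMap.congr_fun (f := d ∘ₗ ofComponents 𝒜 (fun i => proj (i - 1) ∘ₗ g) ∘ₗ d)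
      (g := d) (IsContraction.linearMap_ext (𝒜 := 𝒜) fun i x hx => ?_) x
    have hdx := hdg.d_deg i x hx
    simp only [LinearMap.comp_apply]
    rw [happly hdx, hproj_d, hg, sub_add_cancel, hproj, DirectSum.decompose_of_mem_same 𝒜 hdx]
  · rw [happly SetLike.GradedOne.one_mem, h1, map_zero]

lemma exists_isContraction [SetLike.GradedMonoid 𝒜] (hdg : IsDGAlgebra 𝒜 d) :
    ∃ σ h π : A →ₗ[k] A, IsContraction 𝒜 d σ h π := by
  obtain ⟨g, hdeg, hg, hone⟩ := exists_graded_pseudoInverse hdg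
  have hd1 : d 1 = 0 := by
    have h1 := hdg.leibniz 0 1 SetLike.GradedOne.one_mem 1
    simpa using h1
  let g' : A →ₗ[k] A := g ∘ₗ d ∘ₗ g
  have hg' (x : A) : g' x = g (d (g x)) := rfl
  let h : A →ₗ[k] A := g' - g' ∘ₗ g' ∘ₗ d
  have hh (x : A) : h x = g (d (g x)) - g (d (g (g (d (g (d x)))))) := rfl
  have hdd := hdg.d_sq
  let π : A →ₗ[k] A := LinearMap.id - d ∘ₗ h - h ∘ₗ d
  have hπ (x : A) : π x = x - d (h x) - h (d x) := rfl
  have hh_h (x : A) : h (h x) = 0 := by simp [hh, hg]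
  have hdhd (x : A) : d (h (d x)) = d x := by simp [hh, hdd, hg]
  have hhdh (x : A) : h (d (h x)) = h x := by simp [hh, hdd, hg]
  have hh_mem (i : ℤ) (x : A) (hx : x ∈ 𝒜 i) : h x ∈ 𝒜 (i - 1) := by
    have hg'_mem {j : ℤ} {y : A} (hy : y ∈ 𝒜 j) : g (d (g y)) ∈ 𝒜 (j - 1) := by
      simpa using hdeg _ _ (hdg.d_deg _ _ (hdeg _ _ hy))
    refine sub_mem (hg'_mem hx) ?_
    have hmem := hg'_mem (hg'_mem (hdg.d_deg _ _ hx))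
    rwa [add_sub_cancel_right] at hmem
  have hπ_d (x : A) : π (d x) = 0 := by simp [hπ, hdhd, hdd]
  have hπ_h (x : A) : π (h x) = 0 := by simp [hπ, hhdh, hh_h]
  refine ⟨ofComponents 𝒜 fun i => gsign i • LinearMap.id, h, π,
    { σ_apply := fun i x hx => ofComponents_apply 𝒜 _ hx
      h_mem := hh_mem
      π_mem := fun i x hx => ?_
      homotopy := fun x => by rw [hπ]; abel
      h_h := hh_h
      h_π := fun x => by simp [hπ, hhdh, hh_h]
      π_h := hπ_h
      π_d := hπ_d
      d_π := fun x => by simp [hπ, hdhd, hdd]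
      π_π := fun x => by
        conv_lhs => rw [hπ x]
        rw [map_sub, map_sub, hπ_d, hπ_h, sub_zero, sub_zero]
      π_one := ?_ }⟩
  · refine sub_mem (sub_mem hx ?_) ?_
    · simpa using hdg.d_deg _ _ (hh_mem i x hx)
    · simpa using hh_mem _ _ (hdg.d_deg i x hx)
  · rcases hone with ⟨x, hx⟩ | h1
    · exact .inr (by rw [← hx, hπ_d])
    · exact .inl (by simp [hπ, hh, hd1, h1])

end Existence

/-- **Minimality Theorem, Kadeishvili.** Let `A` be a dg-algebra over
a field `k` whose homology is a free `k`-module. Then there is an `A_∞`-algebra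
structure `(mₙ)` on `H_*(A)` (encoded by `M`) and an `A_∞`-quasi-isomorphism
`(fₙ) : H_*(A) → A` (encoded by `F`) such that `f₁` is a cycle-choosing
quasi-isomorphism, `m₁ = 0` and `m₂` is the induced multiplication; moreover, since
`A` is unital, the structure and the morphism can be chosen strictly unital:
`f_k(…, c·1, …) = 0` for `k ≥ 2` and `m_k(…, c·1, …) = 0` for `k ≥ 3`. -/
theorem stmt0 (𝒜 : ℤ → Submodule k A) [SetLike.GradedMonoid 𝒜]
    [DirectSum.Decomposition 𝒜]
    (d : A →ₗ[k] A) (hdg : IsDGAlgebra 𝒜 d)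
    (hfree : Module.Free k
      (↥(LinearMap.ker d) ⧸
        Submodule.comap (LinearMap.ker d).subtype (LinearMap.range d))) :
    ∃ M F : List A → A,
      (∀ N, EncodesOps d M N) ∧ (∀ N, EncodesFamily d F N) ∧
      IsCycleChoosing d F ∧
      MOneZero d M ∧ MTwoInduced d M ∧
      (∀ N, OpsHaveDegree 𝒜 M N) ∧ (∀ N, MapsHaveDegree 𝒜 F N) ∧
      (∀ N, SatisfiesStasheff d 𝒜 M N) ∧ (∀ N, SatisfiesStasheffMorph d 𝒜 F M N) ∧
      (∀ (pre post : List A) (c : k), 2 ≤ pre.length + post.length + 1 →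
        IsCycleList d pre → IsCycleList d post →
        F (pre ++ (c • (1 : A)) :: post) = 0) ∧
      (∀ (pre post : List A) (c : k), 3 ≤ pre.length + post.length + 1 →
        IsCycleList d pre → IsCycleList d post →
        M (pre ++ (c • (1 : A)) :: post) ∈ LinearMap.range d) := by
  obtain ⟨σ, h, π, H⟩ := exists_isContraction hdg
  have hF := treeMap_isListMultilinear σ h π
  have hM := treeOps_isListMultilinear σ h π
  have hπ {a b : List A} (hab : HomologyEquiv d a b) :
      (suspTwist σ a).map π = (suspTwist σ b).map π := by
    rw [H.map_π_suspTwist, H.map_π_suspTwist, H.map_π_eq_of_homologyEquiv hab]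
  have hsub {x : A} (hx : x ∈ LinearMap.ker d) : π x - x ∈ LinearMap.range d := by
    refine ⟨-h x, ?_⟩
    have hhom := H.homotopy x
    rw [LinearMap.mem_ker.mp hx, map_zero, add_zero] at hhom
    rw [map_neg, hhom, neg_sub]
  have hker (x : A) : π x ∈ LinearMap.ker d := H.d_π x
  refine ⟨fun a => treeOps σ h π (suspTwist σ a), fun a => treeMap σ h π (suspTwist σ a),
    fun N => ⟨(hM.comp_suspTwist σ).encodesFamily d (fun a b hab => H.treeOps_congr (hπ hab)) N,
      fun a _ _ => hker _⟩,
    (hF.comp_suspTwist σ).encodesFamily d fun a b hab => H.treeMap_congr (hπ hab),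
    ⟨fun u _ => ?_, fun u hu => ?_⟩, fun u hu => ?_, fun u hu v hv => ?_,
    fun N ds a _ ha => ?_, fun N ds a _ ha => ?_, H.satisfiesStasheff hdg,
    H.satisfiesStasheffMorph hdg, fun p q c hpq _ _ => ?_, fun p q c hpq _ _ => ?_⟩
  · simpa [suspTwist] using hker u
  · simpa [suspTwist] using hsub hu
  · simp [suspTwist, treeOps]
  · have hval : treeOps σ h π (suspTwist σ [u, v]) = π (π u * π v) := by
      simp [suspTwist, treeOps, treeProd_pair, ← H.σ_π, H.σ_σ]
    have hmul : π u * π v ∈ LinearMap.ker d := by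
      rw [LinearMap.mem_ker, H.d_mul hdg, H.d_π, H.d_π, zero_mul, mul_zero, add_zero]
    have hprod : π u * π v - u * v ∈ LinearMap.range d := by
      obtain ⟨x, hx⟩ := hsub hu
      obtain ⟨y, hy⟩ := hsub hv
      refine ⟨x * π v + σ u * y, ?_⟩
      rw [map_add, H.d_mul hdg, H.d_mul hdg, H.d_π, H.σ_σ, hx, hy,
        ← neg_eq_iff_eq_neg.mpr (H.σ_d hdg u), LinearMap.mem_ker.mp hu]
      simp [sub_mul, mul_sub]
    beta_reduce
    rw [hval, ← sub_add_sub_cancel]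
    exact add_mem (hsub hmul) hprod
  · simpa using H.treeOps_mem ds _ (H.isHomogeneousList_suspTwist ha)
  · simpa using H.treeMap_mem ds _ (H.isHomogeneousList_suspTwist ha)
  · obtain ⟨p', hp', htw⟩ := exists_suspTwist_append_cons σ p q
    simp only [htw]
    rw [map_smul, H.σ_pow_apply _ SetLike.GradedOne.one_mem, hF.map_smul, hF.map_gsign,
      H.treeMap_one _ _ (by rw [length_suspTwist]; omega), smul_zero, smul_zero]
  · obtain ⟨p', hp', htw⟩ := exists_suspTwist_append_cons σ p q
    simp only [htw]
    rw [map_smul, H.σ_pow_apply _ SetLike.GradedOne.one_mem, hM.map_smul, hM.map_gsign,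
      H.treeOps_one _ _ (by rw [length_suspTwist]; omega), smul_zero, smul_zero]
    exact zero_mem _
end

section
/- Let A be a dg-algebra over a field k, let q ≥ 2 and κ > 2q−2. Suppose given multilinear maps {m_k}_{k<κ} on H_*(A) and {f_k}_{k<κ} into A (with m_1 = 0, f_1 cycle-choosing) such that f_i = 0 and m_i = 0 for all i with q ≤ i < κ. Then Ψ_κ(a_1,…,a_κ) = 0 for all a_1,…,a_κ ∈ H_*(A); consequently one may take m_κ = 0 and f_κ = 0 in the Kadeishvili construction. -/
/-!
Cycle-level encoding of `A_∞`-structures on the homology of a differential graded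
algebra, following Kadeishvili.

A dg-algebra is presented as a `k`-algebra `A` with a grading `𝒜 : ℤ → Submodule k A`
(a graded monoid giving a direct sum decomposition) and a degree `+1` square-zero
differential `d` satisfying the graded Leibniz rule.

Elements of the homology `H = ker d / im d` are encoded by representing cycles.
A family of multilinear maps `(g_n : H^{⊗n} → A)_n` (resp. with values in `H`) is
encoded by a single function `F : List A → A` (the arity being the list length),
evaluated on lists of representing cycles; that `F` genuinely comes from a family
of multilinear maps on homology is expressed by the predicates below.
-/

open LinearMap

variable {k A : Type*} [Field k] [Ring A] [Algebra k A]

/-- A list of cycles stays one under passing to a list with members among its members. -/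
theorem IsCycleList.of_subset {d : A →ₗ[k] A} {a b : List A} (ha : IsCycleList d a)
    (hba : b ⊆ a) : IsCycleList d b :=
  fun x hx => ha x (hba hx)

theorem IsCycleList.append_cons {d : A →ₗ[k] A} {pre post : List A} {u : A}
    (hpre : IsCycleList d pre) (hu : u ∈ LinearMap.ker d) (hpost : IsCycleList d post) :
    IsCycleList d (pre ++ u :: post) := by
  intro x hx
  rcases List.mem_append.1 hx with hx | hx
  · exact hpre x hx
  · rcases List.mem_cons.1 hx with rfl | hx
    · exact hu
    · exact hpost x hx

theorem IsCycleList.homologyEquiv_refl {d : A →ₗ[k] A} {a : List A} (ha : IsCycleList d a) :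
    HomologyEquiv d a a :=
  List.forall₂_same.2 fun x hx => ⟨ha x hx, ha x hx, by simp⟩

/-- A multilinear family on homology vanishes when one argument is a null-homologous cycle. -/
theorem EncodesFamily.eq_zero_of_mem_range {d : A →ₗ[k] A} {F : List A → A} {N : ℕ}
    (hF : EncodesFamily d F N) {pre post : List A} {u : A}
    (hlen : pre.length + post.length + 1 ≤ N) (hpre : IsCycleList d pre)
    (hker : u ∈ LinearMap.ker d) (hrange : u ∈ LinearMap.range d)
    (hpost : IsCycleList d post) : F (pre ++ u :: post) = 0 := by
  have hequiv : HomologyEquiv d (pre ++ u :: post) (pre ++ (0 : k) • u :: post) :=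
    List.rel_append hpre.homologyEquiv_refl
      (.cons ⟨hker, by simp, by simpa using hrange⟩ hpost.homologyEquiv_refl)
  rw [hF.congr _ _ (by simp; omega) hequiv, hF.map_smul pre 0 u post hlen hpre hker hpost,
    zero_smul]

/-- The obstruction `Ψ_κ` vanishes when the maps and operations vanish at the arities from
`q` to `κ - 1`. -/
theorem Psi_eq_zero {d : A →ₗ[k] A} {q κ : ℕ} (hκ : 2 * q - 2 < κ)
    {M F : List A → A} (hM : EncodesOps d M (κ - 1)) (hF : EncodesFamily d F (κ - 1))
    (hvanF : ∀ a : List A, q ≤ a.length → a.length < κ → IsCycleList d a → F a = 0)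
    (hvanM : ∀ a : List A, q ≤ a.length → a.length < κ → IsCycleList d a →
      M a ∈ LinearMap.range d)
    (ds : List ℤ) {a : List A} (hlen : a.length = κ) (ha : IsCycleList d a) :
    Psi F M ds a = 0 := by
  have htake (n : ℕ) : IsCycleList d (a.take n) := ha.of_subset (List.take_subset n a)
  have hdrop (n : ℕ) : IsCycleList d (a.drop n) := ha.of_subset (List.drop_subset n a)
  unfold Psi
  rw [Finset.sum_eq_zero, Finset.sum_eq_zero, add_zero]
  · intro j hj
    refine Finset.sum_eq_zero fun t ht => ?_
    rw [Finset.mem_Icc] at hj ht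
    have hblock : IsCycleList d ((a.drop t).take j) :=
      (hdrop t).of_subset (List.take_subset j _)
    have hblock_len : ((a.drop t).take j).length = j := by simp; omega
    have hker : M ((a.drop t).take j) ∈ LinearMap.ker d :=
      hM.mem_ker _ (by omega) hblock
    have hpre_len : (a.take t).length = t := by simp; omega
    have hpost_len : (a.drop (t + j)).length = κ - (t + j) := by simp [hlen]
    suffices h : F (a.take t ++ M ((a.drop t).take j) :: a.drop (t + j)) = 0 by
      rw [h, smul_zero]
    by_cases hqj : q ≤ j
    · exact hF.eq_zero_of_mem_range (by omega) (htake t) hker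
        (hvanM _ (by omega) (by omega) hblock) (hdrop _)
    · refine hvanF _ ?_ ?_ ((htake t).append_cons hker (hdrop _)) <;>
        rw [List.length_append, List.length_cons, hpre_len, hpost_len] <;> omega
  · intro s hs
    rw [Finset.mem_Ioo] at hs
    have htake_len : (a.take s).length = s := by simp; omega
    have hdrop_len : (a.drop s).length = κ - s := by simp [hlen]
    by_cases hqs : q ≤ s
    · rw [hvanF (a.take s) (by omega) (by omega) (htake s), zero_mul, smul_zero]
    · rw [hvanF (a.drop s) (by omega) (by omega) (hdrop s), mul_zero, smul_zero]

/-- Let `q ≥ 2` and `κ > 2q-2`. If `f_i = 0` and `m_i = 0` for all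
`q ≤ i < κ`, then `Ψ_κ(a₁,…,a_κ) = 0`; consequently one may take `m_κ = 0` and
`f_κ = 0` in the Kadeishvili construction (the Kadeishvili conditions hold for the
zero choices). -/
theorem stmt7 (𝒜 : ℤ → Submodule k A) [SetLike.GradedMonoid 𝒜]
    [DirectSum.Decomposition 𝒜]
    (d : A →ₗ[k] A) (hdg : IsDGAlgebra 𝒜 d)
    (q κ : ℕ) (hq : 2 ≤ q) (hκ : 2 * q - 2 < κ)
    (M F : List A → A)
    (hM : EncodesOps d M (κ - 1)) (hF : EncodesFamily d F (κ - 1))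
    (hf1 : IsCycleChoosing d F) (hm1 : MOneZero d M)
    (hvanF : ∀ a : List A, q ≤ a.length → a.length < κ → IsCycleList d a → F a = 0)
    (hvanM : ∀ a : List A, q ≤ a.length → a.length < κ → IsCycleList d a →
      M a ∈ LinearMap.range d) :
    ∀ (ds : List ℤ) (a : List A), a.length = κ → IsCycleList d a →
      IsHomogeneousList 𝒜 ds a →
      Psi F M ds a = 0 ∧
      (0 : A) - Psi F M ds a ∈ LinearMap.range d ∧
      d 0 = Psi F M ds a - F [(0 : A)] := by
  intro ds a hlen ha _
  have hPsi : Psi F M ds a = 0 := Psi_eq_zero hκ hM hF hvanF hvanM ds hlen ha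
  have hF0 : F [(0 : A)] = 0 :=
    hF.eq_zero_of_mem_range (pre := []) (post := []) (by simp; omega) (by simp [IsCycleList])
      (zero_mem _) (zero_mem _) (by simp [IsCycleList])
  exact ⟨hPsi, by simp [hPsi], by simp [hPsi, hF0]⟩
end
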